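/- Let R be a commutative Noetherian ring, a an ideal of R, and let M and N be two finitely generated R-modules of the same finite dimension d with Assh_R N = Assh_R M. Then Att_R H^d_a(N) = Att_R H^d_a(M) and Supp_R H^d_a(N) = Supp_R H^d_a(M); in particular, H^d_a(N) = 0 if and only if H^d_a(M) = 0. -/

import Mathlib

/- Common definitions: local cohomology modules, cohomological dimension, module dimension,
secondary representations and attached primes. -/

open CategoryTheory TensorProduct

/-- The `i`-th local cohomology module `H^i_a(M)`, as a type with its `R`-module structure. -/
noncomputable def TopLC (R : Type) [CommRing R] (a : Ideal R) (i : ℕ)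
    (M : Type) [AddCommGroup M] [Module R M] : Type :=
  ((localCohomology a i).obj (ModuleCat.of R M))

noncomputable instance (R : Type) [CommRing R] (a : Ideal R) (i : ℕ)
    (M : Type) [AddCommGroup M] [Module R M] : AddCommGroup (TopLC R a i M) :=
  inferInstanceAs (AddCommGroup ((localCohomology a i).obj (ModuleCat.of R M)))

noncomputable instance (R : Type) [CommRing R] (a : Ideal R) (i : ℕ)
    (M : Type) [AddCommGroup M] [Module R M] : Module R (TopLC R a i M) :=
  inferInstanceAs (Module R ((localCohomology a i).obj (ModuleCat.of R M)))

/-- The cohomological dimension `cd_R(a, M) = sup { i | H^i_a(M) ≠ 0 }`,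
with value `⊥` if all local cohomology modules vanish. -/
noncomputable def cohDim (R : Type) [CommRing R] (a : Ideal R)
    (M : Type) [AddCommGroup M] [Module R M] : WithBot ℕ∞ :=
  sSup {n : WithBot ℕ∞ | ∃ i : ℕ, n = (i : ℕ) ∧ Nontrivial (TopLC R a i M)}

/-- The (Krull) dimension of a module, i.e. the Krull dimension of its support. -/
noncomputable def moduleDim (R : Type) [CommRing R]
    (M : Type) [AddCommGroup M] [Module R M] : WithBot ℕ∞ :=
  Order.krullDim (Module.support R M)

/-- `Assh_R M`: the associated primes `p` of `M` with `dim R/p = dim M`. -/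
noncomputable def Assh (R : Type) [CommRing R]
    (M : Type) [AddCommGroup M] [Module R M] : Set (Ideal R) :=
  { p | p ∈ associatedPrimes R M ∧ ringKrullDim (R ⧸ p) = moduleDim R M }

/-- A submodule `S` is secondary if `S ≠ 0` and every `r : R` acts on `S` either
surjectively or nilpotently. -/
def IsSecondarySub (R : Type) [CommRing R] {M : Type} [AddCommGroup M] [Module R M]
    (S : Submodule R M) : Prop :=
  S ≠ ⊥ ∧ ∀ r : R, (∀ m ∈ S, ∃ s ∈ S, r • s = m) ∨ (∃ n : ℕ, ∀ m ∈ S, r ^ n • m = 0)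

/-- A module is representable if it is the (finite) sum of secondary submodules. -/
def IsRepresentable (R : Type) [CommRing R] (M : Type) [AddCommGroup M] [Module R M] : Prop :=
  ∃ (n : ℕ) (S : Fin n → Submodule R M), (∀ i, IsSecondarySub R (S i)) ∧ (⨆ i, S i) = ⊤

/-- A minimal secondary representation: secondary submodules summing to the whole module,
with pairwise distinct attached primes, none contained in the sum of the others. -/
def IsMinimalRep (R : Type) [CommRing R] {M : Type} [AddCommGroup M] [Module R M]
    {n : ℕ} (S : Fin n → Submodule R M) : Prop :=
  (∀ i, IsSecondarySub R (S i)) ∧ (⨆ i, S i) = ⊤ ∧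
    (Function.Injective fun i => (S i).annihilator.radical) ∧
    ∀ j, ¬ (S j ≤ ⨆ i ∈ ({j}ᶜ : Set (Fin n)), S i)

/-- The attached primes of a module: the radicals of the annihilators of the terms of a
minimal secondary representation. -/
def AttachedPrimes (R : Type) [CommRing R] (M : Type) [AddCommGroup M] [Module R M] :
    Set (Ideal R) :=
  { p | ∃ (n : ℕ) (S : Fin n → Submodule R M), IsMinimalRep R S ∧
      ∃ i, p = (S i).annihilator.radical }

/-- `stab b N = ⟨b⟩N = ⋂ₙ bⁿN`. -/
def stab {R M : Type} [CommRing R] [AddCommGroup M] [Module R M]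
    (b : Ideal R) (N : Submodule R M) : Submodule R M :=
  ⨅ n : ℕ, b ^ n • N

section
open Limits Opposite

section OpHomology
variable {R : Type} [CommRing R] (K : ChainComplex (ModuleCat.{0} R)ᵒᵖ ℕ)

lemma pOpcycles_unop_injective (n : ℕ) : Function.Injective (K.pOpcycles n).unop :=
  (ModuleCat.mono_iff_injective _).1 inferInstance

lemma exists_pOpcycles_unop_eq (n : ℕ) (f : (K.X n).unop) (hf : (K.d (n + 1) n).unop f = 0) :
    ∃ y, (K.pOpcycles n).unop y = f := by
  have h : (ShortComplex.mk (K.d (n + 1) n) (K.pOpcycles n) (by simp)).Exact :=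
    ShortComplex.exact_of_g_is_cokernel _ (K.opcyclesIsCokernel (n + 1) n (by simp))
  exact (ShortComplex.moduleCat_exact_iff _).1 h.unop f hf

lemma d_unop_pOpcycles_unop (n : ℕ) (y) :
    (K.d (n + 1) n).unop ((K.pOpcycles n).unop y) = 0 := by
  have : (K.pOpcycles n).unop ≫ (K.d (n + 1) n).unop = 0 := by
    rw [← unop_comp]; simp
  exact congr($this y)

lemma homologyι_unop_surjective (n : ℕ) : Function.Surjective (K.homologyι n).unop :=
  (ModuleCat.epi_iff_surjective _).1 inferInstance

lemma homologyι_unop_eq_zero_iff (n j : ℕ) (hj : (ComplexShape.down ℕ).next n = j)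
    (y : (K.opcycles n).unop) :
    (K.homologyι n).unop y = 0 ↔ ∃ g, (K.d n j).unop g = (K.pOpcycles n).unop y := by
  have h : (ShortComplex.mk (K.homologyι n) (K.fromOpcycles n j) (by simp)).Exact :=
    ShortComplex.exact_of_f_is_kernel _ (K.homologyIsKernel n j hj)
  have hd : (K.fromOpcycles n j).unop ≫ (K.pOpcycles n).unop = (K.d n j).unop := by
    rw [← unop_comp]; simp
  have h0 : (K.fromOpcycles n j).unop ≫ (K.homologyι n).unop = 0 := by
    rw [← unop_comp]; simp
  constructor
  · intro hy
    obtain ⟨g, hg⟩ := (ShortComplex.moduleCat_exact_iff _).1 h.unop y hy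
    refine ⟨g, ?_⟩
    rw [← hd, ← hg]; rfl
  · rintro ⟨g, hg⟩
    have : (K.fromOpcycles n j).unop g = y := by
      apply pOpcycles_unop_injective
      rw [← hg, ← hd]; rfl
    rw [← this]
    exact congr($h0 g)

end OpHomology

section
variable {C : Type*} [Category C] [Abelian C] [HasExt.{0} C] {X : C} (P : ProjectiveResolution X) {Y : C}
open Abelian CochainComplex HomComplex

lemma extMk_eq_zero_iff_next {n : ℕ} (f : P.complex.X n ⟶ Y)
    (hf : P.complex.d (n + 1) n ≫ f = 0) (j : ℕ) (hj : (ComplexShape.down ℕ).next n = j) :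
    P.extMk f (n + 1) rfl hf = 0 ↔ ∃ g : P.complex.X j ⟶ Y, P.complex.d n j ≫ g = f := by
  cases n with
  | succ p =>
    obtain rfl : p = j := by simpa using hj
    exact P.extMk_eq_zero_iff f _ rfl hf p rfl
  | zero =>
    obtain rfl : 0 = j := by simpa using hj
    simp only [← P.extEquivCohomologyClass.apply_eq_iff_eq,
      ProjectiveResolution.extEquivCohomologyClass_extMk,
      ProjectiveResolution.extEquivCohomologyClass_zero,
      CohomologyClass.mk_eq_zero_iff]
    rw [Cocycle.toSingleMk_mem_coboundaries_iff _ _ _ _ _ 1 (by simp)]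
    have h1 : IsZero (P.cochainComplex.X 1) :=
      CochainComplex.isZero_of_isStrictlyLE _ 0 _
    constructor
    · rintro ⟨g, hg⟩
      refine ⟨0, ?_⟩
      rw [h1.eq_of_src g 0, comp_zero] at hg
      rw [comp_zero, ← cancel_epi (P.cochainComplexXIso (-(0:ℕ)) 0 rfl).hom, ← hg, comp_zero]
    · rintro ⟨g, hg⟩
      refine ⟨0, ?_⟩
      simp at hg
      simp [← hg]

end

section OldExt
variable {R : Type} [CommRing R] {X : ModuleCat.{0} R} (P : ProjectiveResolution X) (Y : ModuleCat.{0} R)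

noncomputable abbrev opYonedaComplex : ChainComplex (ModuleCat.{0} R)ᵒᵖ ℕ :=
  (((linearYoneda R (ModuleCat.{0} R)).obj Y).rightOp.mapHomologicalComplex _).obj P.complex

noncomputable abbrev opYonedaIso (n : ℕ) :
    ((Ext R (ModuleCat.{0} R) n).obj (op X)).obj Y ≅ ((opYonedaComplex P Y).homology n).unop :=
  (P.isoLeftDerivedObj ((linearYoneda R (ModuleCat.{0} R)).obj Y).rightOp n).unop.symm

variable {Y} in
/-- The class `x` in `Ext` is represented by the cocycle `f` on the resolution `P`. -/
def ExtRep {n : ℕ} (f : P.complex.X n ⟶ Y)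
    (x : ((Ext R (ModuleCat.{0} R) n).obj (op X)).obj Y) : Prop :=
  ∃ y, ((opYonedaComplex P Y).pOpcycles n).unop y = f ∧
    ((opYonedaComplex P Y).homologyι n).unop y = (opYonedaIso P Y n).hom x

variable {Y} {P}

lemma ExtRep.exists_rep {n : ℕ} (x : ((Ext R (ModuleCat.{0} R) n).obj (op X)).obj Y) :
    ∃ f, ExtRep P f x := by
  obtain ⟨y, hy⟩ := homologyι_unop_surjective (opYonedaComplex P Y) n ((opYonedaIso P Y n).hom x)
  exact ⟨_, y, rfl, hy⟩

lemma ExtRep.exists_class {n : ℕ} (f : P.complex.X n ⟶ Y) (hf : P.complex.d (n + 1) n ≫ f = 0) :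
    ∃ x, ExtRep P f x := by
  obtain ⟨y, hy⟩ := exists_pOpcycles_unop_eq (opYonedaComplex P Y) n f hf
  exact ⟨(opYonedaIso P Y n).inv (((opYonedaComplex P Y).homologyι n).unop y), y, hy,
    ((opYonedaIso P Y n).toLinearEquiv.apply_symm_apply _).symm⟩

lemma ExtRep.d_comp {n : ℕ} {f : P.complex.X n ⟶ Y}
    {x : ((Ext R (ModuleCat.{0} R) n).obj (op X)).obj Y} (h : ExtRep P f x) :
    P.complex.d (n + 1) n ≫ f = 0 := by
  obtain ⟨y, rfl, hx⟩ := h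
  exact d_unop_pOpcycles_unop (opYonedaComplex P Y) n y

lemma ExtRep.eq_zero_iff {n : ℕ} {f : P.complex.X n ⟶ Y}
    {x : ((Ext R (ModuleCat.{0} R) n).obj (op X)).obj Y} (h : ExtRep P f x) (j : ℕ)
    (hj : (ComplexShape.down ℕ).next n = j) :
    x = 0 ↔ ∃ g : P.complex.X j ⟶ Y, P.complex.d n j ≫ g = f := by
  obtain ⟨y, rfl, hx⟩ := h
  refine Iff.trans ?_ (homologyι_unop_eq_zero_iff (opYonedaComplex P Y) n j hj y)
  rw [hx]
  exact (map_eq_zero_iff _ (opYonedaIso P Y n).toLinearEquiv.injective).symm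

lemma ExtRep.add {n : ℕ} {f f' : P.complex.X n ⟶ Y}
    {x x' : ((Ext R (ModuleCat.{0} R) n).obj (op X)).obj Y} (h : ExtRep P f x)
    (h' : ExtRep P f' x') : ExtRep P (f + f') (x + x') := by
  obtain ⟨y, rfl, hx⟩ := h
  obtain ⟨y', rfl, hx'⟩ := h'
  refine ⟨y + y', by rw [map_add]; rfl, by rw [map_add, map_add, hx, hx']⟩

lemma ExtRep.smul {n : ℕ} {f : P.complex.X n ⟶ Y}
    {x : ((Ext R (ModuleCat.{0} R) n).obj (op X)).obj Y} (h : ExtRep P f x) (r : R) :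
    ExtRep P (r • f) (r • x) := by
  obtain ⟨y, rfl, hx⟩ := h
  refine ⟨r • y, by rw [map_smul]; rfl, by rw [map_smul, map_smul, hx]⟩

lemma ExtRep.map_right {n : ℕ} {f : P.complex.X n ⟶ Y}
    {x : ((Ext R (ModuleCat.{0} R) n).obj (op X)).obj Y} (h : ExtRep P f x)
    {Y' : ModuleCat.{0} R} (g : Y ⟶ Y') :
    ExtRep P (f ≫ g) (((Ext R (ModuleCat.{0} R) n).obj (op X)).map g x) := by
  obtain ⟨y, rfl, hx⟩ := h
  let φ : opYonedaComplex P Y' ⟶ opYonedaComplex P Y :=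
    (NatTrans.mapHomologicalComplex (NatTrans.rightOp ((linearYoneda R (ModuleCat.{0} R)).map g)) _).app P.complex
  have h1 : ((opYonedaComplex P Y).pOpcycles n).unop ≫ (φ.f n).unop =
      (HomologicalComplex.opcyclesMap φ n).unop ≫ ((opYonedaComplex P Y').pOpcycles n).unop := by
    rw [← unop_comp, ← unop_comp, HomologicalComplex.p_opcyclesMap]
  have h2 : ((opYonedaComplex P Y).homologyι n).unop ≫ (HomologicalComplex.homologyMap φ n).unop =
      (HomologicalComplex.opcyclesMap φ n).unop ≫ ((opYonedaComplex P Y').homologyι n).unop := by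
    rw [← unop_comp, ← unop_comp, HomologicalComplex.homologyι_naturality]
  have h3 : ((Ext R (ModuleCat.{0} R) n).obj (op X)).map g ≫ (opYonedaIso P Y' n).hom =
      (opYonedaIso P Y n).hom ≫ (HomologicalComplex.homologyMap φ n).unop := by
    have h := ProjectiveResolution.leftDerived_app_eq
      (NatTrans.rightOp ((linearYoneda R (ModuleCat.{0} R)).map g)) P n
    exact congrArg Quiver.Hom.unop ((Iso.inv_comp_eq _).2 h)
  refine ⟨(HomologicalComplex.opcyclesMap φ n).unop y, ?_, ?_⟩
  · exact congr($h1 y).symm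
  · exact (congr($h2 y).symm.trans congr((HomologicalComplex.homologyMap φ n).unop $hx)).trans congr($h3 x).symm

lemma ExtRep.map_left {n : ℕ} {f : P.complex.X n ⟶ Y}
    {x : ((Ext R (ModuleCat.{0} R) n).obj (op X)).obj Y} (h : ExtRep P f x)
    {X' : ModuleCat.{0} R} {P' : ProjectiveResolution X'} {g : X' ⟶ X}
    (ψ : ProjectiveResolution.Hom P' P g) :
    ExtRep P' (ψ.hom.f n ≫ f) (((Ext R (ModuleCat.{0} R) n).map g.op).app Y x) := by
  obtain ⟨y, rfl, hx⟩ := h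
  let φ : opYonedaComplex P' Y ⟶ opYonedaComplex P Y :=
    (((linearYoneda R (ModuleCat.{0} R)).obj Y).rightOp.mapHomologicalComplex _).map ψ.hom
  have h1 : ((opYonedaComplex P Y).pOpcycles n).unop ≫ (φ.f n).unop =
      (HomologicalComplex.opcyclesMap φ n).unop ≫ ((opYonedaComplex P' Y).pOpcycles n).unop := by
    rw [← unop_comp, ← unop_comp, HomologicalComplex.p_opcyclesMap]
  have h2 : ((opYonedaComplex P Y).homologyι n).unop ≫ (HomologicalComplex.homologyMap φ n).unop =
      (HomologicalComplex.opcyclesMap φ n).unop ≫ ((opYonedaComplex P' Y).homologyι n).unop := by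
    rw [← unop_comp, ← unop_comp, HomologicalComplex.homologyι_naturality]
  have h3 : ((Ext R (ModuleCat.{0} R) n).map g.op).app Y ≫ (opYonedaIso P' Y n).hom =
      (opYonedaIso P Y n).hom ≫ (HomologicalComplex.homologyMap φ n).unop := by
    have h := ProjectiveResolution.isoLeftDerivedObj_inv_naturality g P' P ψ.hom
      (by simpa using ψ.hom_f_zero_comp_π_f_zero)
      ((linearYoneda R (ModuleCat.{0} R)).obj Y).rightOp n
    exact congrArg Quiver.Hom.unop h
  refine ⟨(HomologicalComplex.opcyclesMap φ n).unop y, ?_, ?_⟩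
  · exact congr($h1 y).symm
  · exact (congr($h2 y).symm.trans congr((HomologicalComplex.homologyMap φ n).unop $hx)).trans congr($h3 x).symm

end OldExt

section ExtComparison
variable {R : Type} [CommRing R]

lemma ExtRep.neg {X Y : ModuleCat.{0} R} {P : ProjectiveResolution X} {n : ℕ}
    {f : P.complex.X n ⟶ Y}
    {x : ((Ext R (ModuleCat.{0} R) n).obj (op X)).obj Y} (h : ExtRep P f x) :
    ExtRep P (-f) (-x) := by
  simpa using h.smul (-1)

lemma ExtRep.extMk_eq {X Y : ModuleCat.{0} R} {P : ProjectiveResolution X} {n : ℕ}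
    {f f' : P.complex.X n ⟶ Y} {x : ((Ext R (ModuleCat.{0} R) n).obj (op X)).obj Y}
    (h : ExtRep P f x) (h' : ExtRep P f' x) :
    P.extMk f (n + 1) rfl h.d_comp = P.extMk f' (n + 1) rfl h'.d_comp := by
  rw [← sub_eq_zero, P.sub_extMk, extMk_eq_zero_iff_next P _ _ _ rfl, sub_eq_add_neg]
  exact ((h.add h'.neg).eq_zero_iff _ rfl).1 (add_neg_cancel x)

lemma projRes_hom_exists {X X' : ModuleCat.{0} R} (P' : ProjectiveResolution X')
    (P : ProjectiveResolution X) (g : X' ⟶ X) :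
    Nonempty (ProjectiveResolution.Hom P' P g) :=
  ⟨⟨ProjectiveResolution.lift g P' P, (ProjectiveResolution.lift_commutes_zero g P' P).trans (by simp)⟩⟩

/-- The comparison of the two constructions of `Ext` in module categories. -/
noncomputable def extToExt (X Y : ModuleCat.{0} R) (n : ℕ) :
    ((Ext R (ModuleCat.{0} R) n).obj (op X)).obj Y →ₗ[R] Abelian.Ext X Y n where
  toFun x := (projectiveResolution X).extMk _ (n + 1) rfl (ExtRep.exists_rep x).choose_spec.d_comp
  map_add' x y := by
    rw [ProjectiveResolution.add_extMk]
    exact ExtRep.extMk_eq (ExtRep.exists_rep (x + y)).choose_spec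
      ((ExtRep.exists_rep x).choose_spec.add (ExtRep.exists_rep y).choose_spec)
  map_smul' r x := by
    dsimp only [RingHom.id_apply]
    rw [Abelian.Ext.smul_eq_comp_mk₀, ProjectiveResolution.extMk_comp_mk₀]
    refine ExtRep.extMk_eq (ExtRep.exists_rep (r • x)).choose_spec ?_
    simpa using (ExtRep.exists_rep x).choose_spec.smul r

lemma extToExt_eq {X Y : ModuleCat.{0} R} {n : ℕ} {f : (projectiveResolution X).complex.X n ⟶ Y}
    {x : ((Ext R (ModuleCat.{0} R) n).obj (op X)).obj Y} (h : ExtRep (projectiveResolution X) f x) :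
    extToExt X Y n x = (projectiveResolution X).extMk f (n + 1) rfl h.d_comp :=
  ExtRep.extMk_eq (ExtRep.exists_rep x).choose_spec h

lemma extToExt_bijective (X Y : ModuleCat.{0} R) (n : ℕ) :
    Function.Bijective (extToExt X Y n) := by
  constructor
  · rw [injective_iff_map_eq_zero]
    intro x hx
    obtain ⟨f, hf⟩ := ExtRep.exists_rep (P := projectiveResolution X) x
    rw [extToExt_eq hf, extMk_eq_zero_iff_next _ _ _ _ rfl] at hx
    exact (hf.eq_zero_iff _ rfl).2 hx
  · intro c
    obtain ⟨f, hf, rfl⟩ := (projectiveResolution X).extMk_surjective c (n + 1) rfl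
    obtain ⟨x, hx⟩ := ExtRep.exists_class f hf
    exact ⟨x, extToExt_eq hx⟩

lemma extToExt_map_right {X Y Y' : ModuleCat.{0} R} {n : ℕ} (g : Y ⟶ Y')
    (x : ((Ext R (ModuleCat.{0} R) n).obj (op X)).obj Y) :
    extToExt X Y' n (((Ext R (ModuleCat.{0} R) n).obj (op X)).map g x) =
      (extToExt X Y n x).comp (.mk₀ g) (add_zero n) := by
  obtain ⟨f, hf⟩ := ExtRep.exists_rep (P := projectiveResolution X) x
  rw [extToExt_eq hf, extToExt_eq (hf.map_right g), ProjectiveResolution.extMk_comp_mk₀]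

lemma extToExt_map_left {X X' Y : ModuleCat.{0} R} {n : ℕ} (g : X' ⟶ X)
    (x : ((Ext R (ModuleCat.{0} R) n).obj (op X)).obj Y) :
    extToExt X' Y n (((Ext R (ModuleCat.{0} R) n).map g.op).app Y x) =
      (Abelian.Ext.mk₀ g).comp (extToExt X Y n x) (zero_add n) := by
  obtain ⟨f, hf⟩ := ExtRep.exists_rep (P := projectiveResolution X) x
  obtain ⟨ψ⟩ := projRes_hom_exists (projectiveResolution X') (projectiveResolution X) g
  rw [extToExt_eq hf, extToExt_eq (hf.map_left ψ), ProjectiveResolution.mk₀_comp_extMk]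

end ExtComparison

section LC
variable {R : Type} [CommRing R] (a : Ideal R)

/-- The transition map `R ⧸ a ^ m → R ⧸ a ^ n` for `n ≤ m`. -/
noncomputable def powQuotMap {n m : ℕ} (h : n ≤ m) :
    ModuleCat.of R (R ⧸ a ^ m) ⟶ ModuleCat.of R (R ⧸ a ^ n) :=
  ModuleCat.ofHom (Submodule.mapQ _ _ LinearMap.id (Ideal.pow_le_pow_right h))

/-- The class in local cohomology of an element of `Ext (R ⧸ a ^ n) M`. -/
noncomputable def extToLC (i n : ℕ) (M : ModuleCat.{0} R) :
    Abelian.Ext (ModuleCat.of R (R ⧸ a ^ n)) M i →ₗ[R] (localCohomology a i).obj M :=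
  ((colimit.ι (localCohomology.diagram (localCohomology.idealPowersDiagram a) i)
    (op (op n))).app M).hom ∘ₗ
    (LinearEquiv.ofBijective _ (extToExt_bijective (ModuleCat.of R (R ⧸ a ^ n)) M i)).symm.toLinearMap

variable {a} {i : ℕ}

lemma extToLC_extToExt {n : ℕ} {M : ModuleCat.{0} R}
    (x : ((Ext R (ModuleCat.{0} R) i).obj (op (ModuleCat.of R (R ⧸ a ^ n)))).obj M) :
    extToLC a i n M (extToExt _ _ _ x) =
    ((colimit.ι (localCohomology.diagram (localCohomology.idealPowersDiagram a) i)
    (op (op n))).app M).hom x := by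
  exact congrArg _ (LinearEquiv.ofBijective_symm_apply_apply (extToExt _ _ _) (h := extToExt_bijective _ _ _) x)

noncomputable def isColimitLC (a : Ideal R) (i : ℕ) (M : ModuleCat.{0} R) :=
  isColimitOfPreserves ((evaluation (ModuleCat.{0} R) (ModuleCat.{0} R)).obj M)
    (colimit.isColimit (localCohomology.diagram (localCohomology.idealPowersDiagram a) i))

lemma exists_extToLC {M : ModuleCat.{0} R} (x : (localCohomology a i).obj M) :
    ∃ n c, extToLC a i n M c = x := by
  obtain ⟨n, y, hy⟩ := Concrete.isColimit_exists_rep _ (isColimitLC a i M) x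
  exact ⟨n.unop.unop, _, (extToLC_extToExt y).trans hy⟩

lemma extToLC_map {n : ℕ} {M M' : ModuleCat.{0} R} (g : M ⟶ M')
    (c : Abelian.Ext (ModuleCat.of R (R ⧸ a ^ n)) M i) :
    (localCohomology a i).map g (extToLC a i n M c) =
      extToLC a i n M' (c.comp (.mk₀ g) (add_zero i)) := by
  obtain ⟨x, rfl⟩ := (extToExt_bijective _ _ _).2 c
  rw [← extToExt_map_right, extToLC_extToExt, extToLC_extToExt]
  exact congr($((colimit.ι (localCohomology.diagram (localCohomology.idealPowersDiagram a) i)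
    (op (op n))).naturality g) x).symm

lemma extToLC_eq_zero_iff {n : ℕ} {M : ModuleCat.{0} R}
    (c : Abelian.Ext (ModuleCat.of R (R ⧸ a ^ n)) M i) :
    extToLC a i n M c = 0 ↔
      ∃ (m : ℕ) (h : n ≤ m), (Abelian.Ext.mk₀ (powQuotMap a h)).comp c (zero_add i) = 0 := by
  obtain ⟨x, rfl⟩ := (extToExt_bijective _ _ _).2 c
  rw [extToLC_extToExt]
  have key := Concrete.isColimit_rep_eq_iff_exists _ (isColimitLC a i M)
    (i := op (op n)) (j := op (op n)) x 0
  rw [map_zero] at key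
  refine key.trans ?_
  constructor
  · rintro ⟨k, f, g, h⟩
    refine ⟨k.unop.unop, f.unop.unop.le, ?_⟩
    rw [← extToExt_map_left]
    refine (congrArg _ (h.trans ?_)).trans (map_zero _)
    exact map_zero (ModuleCat.Hom.hom _)
  · rintro ⟨m, h, h0⟩
    rw [← extToExt_map_left] at h0
    refine ⟨op (op m), (homOfLE h).op.op, (homOfLE h).op.op, ?_⟩
    refine ((extToExt_bijective _ _ _).1 (h0.trans (map_zero _).symm)).trans ?_
    exact (map_zero (ModuleCat.Hom.hom _)).symm

lemma extToLC_precomp {n m : ℕ} {M : ModuleCat.{0} R} (h : n ≤ m)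
    (c : Abelian.Ext (ModuleCat.of R (R ⧸ a ^ n)) M i) :
    extToLC a i m M ((Abelian.Ext.mk₀ (powQuotMap a h)).comp c (zero_add i)) =
      extToLC a i n M c := by
  obtain ⟨x, rfl⟩ := (extToExt_bijective _ _ _).2 c
  rw [← extToExt_map_left, extToLC_extToExt, extToLC_extToExt]
  exact congr(($(colimit.w (localCohomology.diagram (localCohomology.idealPowersDiagram a) i)
    (homOfLE h).op.op)).app M x)

end LC

section LCMap
variable {R : Type} [CommRing R] (a : Ideal R) (i : ℕ)
variable {A B C : Type} [AddCommGroup A] [AddCommGroup B] [AddCommGroup C]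
  [Module R A] [Module R B] [Module R C]

/-- Functoriality of local cohomology in terms of linear maps. -/
noncomputable def lcMap (f : A →ₗ[R] B) : TopLC R a i A →ₗ[R] TopLC R a i B :=
  ((localCohomology a i).map (ModuleCat.ofHom f)).hom

/-- The class in local cohomology of an element of `Ext (R ⧸ a ^ n) A`. -/
noncomputable def lcClass (n : ℕ) (A : Type) [AddCommGroup A] [Module R A] :
    Abelian.Ext (ModuleCat.of R (R ⧸ a ^ n)) (ModuleCat.of R A) i →ₗ[R] TopLC R a i A :=
  extToLC a i n (ModuleCat.of R A)

variable {a i}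

lemma exists_lcClass (x : TopLC R a i A) : ∃ n c, lcClass a i n A c = x :=
  exists_extToLC x

lemma lcMap_lcClass {n : ℕ} (f : A →ₗ[R] B)
    (c : Abelian.Ext (ModuleCat.of R (R ⧸ a ^ n)) (ModuleCat.of R A) i) :
    lcMap a i f (lcClass a i n A c) =
      lcClass a i n B (c.comp (.mk₀ (ModuleCat.ofHom f)) (add_zero i)) :=
  extToLC_map _ c

lemma lcClass_eq_zero_iff {n : ℕ}
    (c : Abelian.Ext (ModuleCat.of R (R ⧸ a ^ n)) (ModuleCat.of R A) i) :
    lcClass a i n A c = 0 ↔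
      ∃ (m : ℕ) (h : n ≤ m), (Abelian.Ext.mk₀ (powQuotMap a h)).comp c (zero_add i) = 0 :=
  extToLC_eq_zero_iff c

lemma lcClass_precomp {n m : ℕ} (h : n ≤ m)
    (c : Abelian.Ext (ModuleCat.of R (R ⧸ a ^ n)) (ModuleCat.of R A) i) :
    lcClass a i m A ((Abelian.Ext.mk₀ (powQuotMap a h)).comp c (zero_add i)) =
      lcClass a i n A c :=
  extToLC_precomp h c

lemma lcMap_smul_id (r : R) (x : TopLC R a i A) :
    lcMap a i (r • LinearMap.id) x = r • x := by
  obtain ⟨n, c, rfl⟩ := exists_lcClass x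
  rw [lcMap_lcClass, ← map_smul, Abelian.Ext.smul_eq_comp_mk₀]
  rfl

lemma lcMap_add_apply (f g : A →ₗ[R] B) (x : TopLC R a i A) :
    lcMap a i (f + g) x = lcMap a i f x + lcMap a i g x := by
  obtain ⟨n, c, rfl⟩ := exists_lcClass x
  rw [lcMap_lcClass, lcMap_lcClass, lcMap_lcClass, ← map_add, ← Abelian.Ext.comp_add,
    ← Abelian.Ext.mk₀_add]
  rfl

lemma lcMap_comp_apply (g : B →ₗ[R] C) (f : A →ₗ[R] B) (x : TopLC R a i A) :
    lcMap a i (g ∘ₗ f) x = lcMap a i g (lcMap a i f x) :=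
  congr($((localCohomology a i).map_comp (ModuleCat.ofHom f) (ModuleCat.ofHom g)) x)

lemma lcMap_id_apply (x : TopLC R a i A) : lcMap a i LinearMap.id x = x := by
  simpa using lcMap_smul_id (1 : R) x

lemma lcMap_zero_apply (x : TopLC R a i A) : lcMap a i (0 : A →ₗ[R] B) x = 0 := by
  have := lcMap_add_apply (0 : A →ₗ[R] B) 0 x
  simpa using this

lemma subsingleton_topLC [Subsingleton A] : Subsingleton (TopLC R a i A) := by
  refine subsingleton_of_forall_eq 0 fun x => ?_
  rw [← lcMap_id_apply x, show (LinearMap.id : A →ₗ[R] A) = 0 from Subsingleton.elim _ _,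
    lcMap_zero_apply]

/-- The short complex attached to an exact pair of linear maps. -/
noncomputable abbrev exactComplex {f : A →ₗ[R] B} {g : B →ₗ[R] C} (he : Function.Exact f g) :
    ShortComplex (ModuleCat.{0} R) :=
  ModuleCat.shortComplexOfCompEqZero f g he.linearMap_comp_eq_zero

lemma exactComplex_shortExact {f : A →ₗ[R] B} {g : B →ₗ[R] C} (he : Function.Exact f g)
    (hf : Function.Injective f) (hg : Function.Surjective g) : (exactComplex he).ShortExact :=
  ModuleCat.shortComplex_shortExact _ he hf hg

lemma lcMap_exact {f : A →ₗ[R] B} {g : B →ₗ[R] C} (he : Function.Exact f g)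
    (hf : Function.Injective f) (hg : Function.Surjective g) :
    Function.Exact (lcMap a i f) (lcMap a i g) := by
  have hS := exactComplex_shortExact he hf hg
  intro x
  constructor
  · intro hx
    obtain ⟨n, c, rfl⟩ := exists_lcClass x
    rw [lcMap_lcClass, lcClass_eq_zero_iff] at hx
    obtain ⟨m, h, hm⟩ := hx
    obtain ⟨e, he⟩ := Abelian.Ext.covariant_sequence_exact₂ _ hS
      ((Abelian.Ext.mk₀ (powQuotMap a h)).comp c (zero_add i))
      ((Abelian.Ext.comp_assoc_of_third_deg_zero _ _ _ _).trans hm)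
    refine ⟨lcClass a i m A e, ?_⟩
    rw [lcMap_lcClass, ← lcClass_precomp h c, ← he]
  · rintro ⟨y, rfl⟩
    rw [← lcMap_comp_apply, he.linearMap_comp_eq_zero, lcMap_zero_apply]

lemma lcMap_surjective_of_subsingleton {f : A →ₗ[R] B} {g : B →ₗ[R] C} (he : Function.Exact f g)
    (hf : Function.Injective f) (hg : Function.Surjective g)
    (hA : Subsingleton (TopLC R a (i + 1) A)) :
    Function.Surjective (lcMap a i g) := by
  have hS := exactComplex_shortExact he hf hg
  intro x
  obtain ⟨n, c, rfl⟩ := exists_lcClass x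
  obtain ⟨m, h, hm⟩ := (lcClass_eq_zero_iff _).1
    (Subsingleton.elim (lcClass a (i + 1) n A (c.comp hS.extClass rfl)) 0)
  obtain ⟨e, he⟩ := Abelian.Ext.covariant_sequence_exact₃ _ hS
    ((Abelian.Ext.mk₀ (powQuotMap a h)).comp c (zero_add i)) rfl
    ((Abelian.Ext.comp_assoc _ _ _ _ _ (by omega)).trans hm)
  refine ⟨lcClass a i m B e, ?_⟩
  rw [lcMap_lcClass, ← lcClass_precomp h c, ← he]

lemma lcMap_injective_of_subsingleton {f : A →ₗ[R] B} {g : B →ₗ[R] C} (he : Function.Exact f g)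
    (hf : Function.Injective f) (hg : Function.Surjective g)
    (hC : Subsingleton (TopLC R a i C)) :
    Function.Injective (lcMap a (i + 1) f) := by
  have hS := exactComplex_shortExact he hf hg
  rw [injective_iff_map_eq_zero]
  intro x hx
  obtain ⟨n, c, rfl⟩ := exists_lcClass x
  rw [lcMap_lcClass, lcClass_eq_zero_iff] at hx
  obtain ⟨m, h, hm⟩ := hx
  obtain ⟨e, he⟩ := Abelian.Ext.covariant_sequence_exact₁ _ hS
    ((Abelian.Ext.mk₀ (powQuotMap a h)).comp c (zero_add _))
    ((Abelian.Ext.comp_assoc_of_third_deg_zero _ _ _ _).trans hm) rfl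
  obtain ⟨m', h', hm'⟩ := (lcClass_eq_zero_iff _).1 (Subsingleton.elim (lcClass a i m C e) 0)
  rw [← lcClass_precomp h c, ← he, ← lcClass_precomp h',
    ← Abelian.Ext.comp_assoc (h₁₂ := zero_add i) (h := by omega), hm', Abelian.Ext.zero_comp,
    map_zero]

lemma smul_lcClass_eq_zero {n : ℕ} {r : R} (hr : r ∈ a ^ n)
    (c : Abelian.Ext (ModuleCat.of R (R ⧸ a ^ n)) (ModuleCat.of R A) i) :
    r • lcClass a i n A c = 0 := by
  have h0 : r • 𝟙 (ModuleCat.of R (R ⧸ a ^ n)) = 0 := by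
    ext
    simpa [Algebra.smul_def, Ideal.Quotient.eq_zero_iff_mem] using hr
  have : r • c = 0 := by
    rw [← Abelian.Ext.mk₀_id_comp c, ← Abelian.Ext.smul_comp, ← Abelian.Ext.mk₀_smul, h0]
    simp
  rw [← map_smul, this, map_zero]

lemma exists_pow_smul_topLC_eq_zero (x : TopLC R a i A) : ∃ n, ∀ r ∈ a ^ n, r • x = 0 := by
  obtain ⟨n, c, rfl⟩ := exists_lcClass x
  exact ⟨n, fun r hr => smul_lcClass_eq_zero hr c⟩

end LCMap

section Annihilated
variable {R : Type} [CommRing R] {a : Ideal R}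

lemma mk₀_comp_eq_zero_of_extClass {A B C A' B' C' D T : Type}
    [AddCommGroup A] [AddCommGroup B] [AddCommGroup C] [Module R A] [Module R B] [Module R C]
    [AddCommGroup A'] [AddCommGroup B'] [AddCommGroup C'] [Module R A'] [Module R B'] [Module R C']
    [AddCommGroup D] [Module R D] [AddCommGroup T] [Module R T]
    {f : A →ₗ[R] B} {g : B →ₗ[R] C} (he : Function.Exact f g)
    (hf : Function.Injective f) (hg : Function.Surjective g)
    {f' : A' →ₗ[R] B'} {g' : B' →ₗ[R] C'} (he' : Function.Exact f' g')
    (hf' : Function.Injective f') (hg' : Function.Surjective g')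
    (u : A' →ₗ[R] D) (s : D →ₗ[R] A) (v : B' →ₗ[R] B) (w : C' →ₗ[R] C)
    (hv : f ∘ₗ s ∘ₗ u = v ∘ₗ f') (hw : g ∘ₗ v = w ∘ₗ g') {j : ℕ}
    (c : Abelian.Ext (ModuleCat.of R A) (ModuleCat.of R T) j)
    (hc : (Abelian.Ext.mk₀ (ModuleCat.ofHom s)).comp c (zero_add j) = 0) :
    (Abelian.Ext.mk₀ (ModuleCat.ofHom w)).comp
      ((exactComplex_shortExact he hf hg).extClass.comp c (add_comm 1 j)) (zero_add (j + 1)) = 0 := by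
  let φ : exactComplex he' ⟶ exactComplex he :=
    { τ₁ := ModuleCat.ofHom (s ∘ₗ u)
      τ₂ := ModuleCat.ofHom v
      τ₃ := ModuleCat.ofHom w
      comm₁₂ := ModuleCat.hom_ext hv
      comm₂₃ := ModuleCat.hom_ext hw }
  have key := ShortComplex.ShortExact.extClass_naturality (exactComplex_shortExact he' hf' hg')
    (exactComplex_shortExact he hf hg) φ
  have h1 : (Abelian.Ext.mk₀ (ModuleCat.ofHom w)).comp
      ((exactComplex_shortExact he hf hg).extClass.comp c (add_comm 1 j)) (zero_add (j + 1)) =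
      ((Abelian.Ext.mk₀ φ.τ₃).comp (exactComplex_shortExact he hf hg).extClass (zero_add 1)).comp c
        (add_comm 1 j) :=
    (Abelian.Ext.comp_assoc _ _ _ _ _ (by omega)).symm
  have h2 : φ.τ₁ = ModuleCat.ofHom u ≫ ModuleCat.ofHom s := rfl
  rw [h1, ← key, Abelian.Ext.comp_assoc_of_second_deg_zero, h2, ← Abelian.Ext.mk₀_comp_mk₀_assoc,
    hc, Abelian.Ext.comp_zero, Abelian.Ext.comp_zero]

lemma mem_of_mem_map_subtype {L : Type} [AddCommGroup L] [Module R L] {p : Submodule R L}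
    {q : Submodule R p} {x : p} (h : (x : L) ∈ q.map p.subtype) : x ∈ q := by
  obtain ⟨y, hy, h⟩ := h
  rwa [← Subtype.ext h]

lemma exists_pow_mk₀_subtype_comp_eq_zero [IsNoetherianRing R] {T : Type} [AddCommGroup T]
    [Module R T] (hT : ∀ r ∈ a, ∀ t : T, r • t = 0) (j : ℕ) (L : Type) [AddCommGroup L] [Module R L]
    [Module.Finite R L] (c : Abelian.Ext (ModuleCat.of R L) (ModuleCat.of R T) j) :
    ∃ m, (Abelian.Ext.mk₀ (ModuleCat.ofHom (a ^ m • ⊤ : Submodule R L).subtype)).comp c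
      (zero_add j) = 0 := by
  induction j generalizing L with
  | zero =>
    obtain ⟨f, rfl⟩ := (Abelian.Ext.mk₀_bijective _ _).2 c
    refine ⟨1, ?_⟩
    rw [Abelian.Ext.mk₀_comp_mk₀]
    have : ModuleCat.ofHom (a ^ 1 • ⊤ : Submodule R L).subtype ≫ f = 0 := by
      ext ⟨x, hx⟩
      change f.hom x = 0
      refine Submodule.smul_induction_on hx (fun r hr l _ => ?_) fun x y h1 h2 => ?_
      · rw [map_smul]
        exact hT r (by simpa using hr) _
      · rw [map_add, h1, h2, add_zero]
    rw [this, Abelian.Ext.mk₀_zero]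
  | succ j ih =>
    obtain ⟨n, g, hg⟩ := Module.Finite.exists_fin' R L
    have he := LinearMap.exact_subtype_ker_map g
    have hf := (LinearMap.ker g).injective_subtype
    obtain ⟨c', rfl⟩ := Abelian.Ext.contravariant_sequence_exact₃
      (exactComplex_shortExact he hf hg) _ c
      (Abelian.Ext.eq_zero_of_projective (P := ModuleCat.of R (Fin n → R)) _) (add_comm 1 j)
    obtain ⟨m₀, hm₀⟩ := ih _ c'
    obtain ⟨k, hk⟩ := Ideal.exists_pow_inf_eq_pow_smul a (LinearMap.ker g)
    have hmap : ∀ x ∈ (a ^ (k + m₀) • ⊤ : Submodule R (Fin n → R)),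
        g x ∈ (a ^ (k + m₀) • ⊤ : Submodule R L) := by
      intro x hx
      have := Submodule.mem_map_of_mem (f := g) hx
      rw [Submodule.map_smul''] at this
      exact Submodule.smul_mono le_rfl le_top this
    obtain ⟨g', hgg'⟩ : ∃ g' : (a ^ (k + m₀) • ⊤ : Submodule R (Fin n → R)) →ₗ[R]
        (a ^ (k + m₀) • ⊤ : Submodule R L), ∀ x, (g' x : L) = g x := ⟨g.restrict hmap, fun _ => rfl⟩
    have hg' : Function.Surjective g' := by
      rintro ⟨y, hy⟩
      have : y ∈ Submodule.map g (a ^ (k + m₀) • ⊤ : Submodule R (Fin n → R)) := by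
        rwa [Submodule.map_smul'', Submodule.map_top, LinearMap.range_eq_top.2 hg]
      obtain ⟨x, hx, rfl⟩ := this
      exact ⟨⟨x, hx⟩, Subtype.ext (hgg' _)⟩
    have hker : ∀ x : LinearMap.ker g', ∃ h : (x : (Fin n → R)) ∈ LinearMap.ker g,
        (⟨_, h⟩ : LinearMap.ker g) ∈ (a ^ m₀ • ⊤ : Submodule R (LinearMap.ker g)) := by
      rintro ⟨⟨x, hx⟩, hx'⟩
      have h1 : x ∈ LinearMap.ker g := (hgg' ⟨x, hx⟩).symm.trans (congrArg Subtype.val hx')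
      refine ⟨h1, ?_⟩
      have h2 := (hk (k + m₀) (by omega)).le ⟨hx, h1⟩
      rw [Nat.add_sub_cancel_left] at h2
      have h3 := Submodule.smul_mono (le_refl (a ^ m₀)) (inf_le_right (a := a ^ k • ⊤)) h2
      refine mem_of_mem_map_subtype ?_
      rw [Submodule.map_smul'', Submodule.map_top, Submodule.range_subtype]
      exact h3
    let u : LinearMap.ker g' →ₗ[R] (a ^ m₀ • ⊤ : Submodule R (LinearMap.ker g)) :=
      { toFun := fun x => ⟨⟨_, (hker x).1⟩, (hker x).2⟩
        map_add' := fun _ _ => rfl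
        map_smul' := fun _ _ => rfl }
    refine ⟨k + m₀, ?_⟩
    have hv : (LinearMap.ker g).subtype ∘ₗ (Submodule.subtype _) ∘ₗ u =
      (a ^ (k + m₀) • ⊤ : Submodule R (Fin n → R)).subtype ∘ₗ (LinearMap.ker g').subtype := rfl
    have hw : g ∘ₗ (a ^ (k + m₀) • ⊤ : Submodule R (Fin n → R)).subtype =
      (a ^ (k + m₀) • ⊤ : Submodule R L).subtype ∘ₗ g' :=
      LinearMap.ext fun x => (hgg' x).symm
    have he' := LinearMap.exact_subtype_ker_map g'
    have hf' := (LinearMap.ker g').injective_subtype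
    exact mk₀_comp_eq_zero_of_extClass (A' := LinearMap.ker g')
      (B' := (a ^ (k + m₀) • ⊤ : Submodule R (Fin n → R)))
      (C' := (a ^ (k + m₀) • ⊤ : Submodule R L)) he hf hg he' hf' hg' u _ _ _ hv hw c' hm₀

lemma subsingleton_topLC_of_annihilated [IsNoetherianRing R] {T : Type} [AddCommGroup T]
    [Module R T] (hT : ∀ r ∈ a, ∀ t : T, r • t = 0) (i : ℕ) :
    Subsingleton (TopLC R a (i + 1) T) := by
  refine subsingleton_of_forall_eq 0 fun x => ?_
  obtain ⟨n, c, rfl⟩ := exists_lcClass x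
  have he : ∀ n, Function.Exact (a ^ n : Submodule R R).subtype (a ^ n : Submodule R R).mkQ :=
    fun n => LinearMap.exact_subtype_mkQ _
  have hf : ∀ n, Function.Injective (a ^ n : Submodule R R).subtype :=
    fun n => Submodule.injective_subtype _
  have hg : ∀ n, Function.Surjective (a ^ n : Submodule R R).mkQ :=
    fun n => Submodule.mkQ_surjective _
  obtain ⟨c', rfl⟩ := Abelian.Ext.contravariant_sequence_exact₃
    (exactComplex_shortExact (he n) (hf n) (hg n)) _ c
    (Abelian.Ext.eq_zero_of_projective (P := ModuleCat.of R R) _) (add_comm 1 i)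
  obtain ⟨m, hm⟩ := exists_pow_mk₀_subtype_comp_eq_zero hT i _ c'
  have hmem : ∀ x : (a ^ (n + m) : Submodule R R),
      (⟨x, Ideal.pow_le_pow_right (Nat.le_add_right n m) x.2⟩ : (a ^ n : Submodule R R)) ∈
        (a ^ m • ⊤ : Submodule R (a ^ n : Submodule R R)) := by
    rintro ⟨x, hx⟩
    refine mem_of_mem_map_subtype ?_
    rw [Submodule.map_smul'', Submodule.map_top, Submodule.range_subtype]
    rwa [smul_eq_mul, ← pow_add, add_comm]
  let u : (a ^ (n + m) : Submodule R R) →ₗ[R] (a ^ m • ⊤ : Submodule R (a ^ n : Submodule R R)) :=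
    { toFun := fun x => ⟨_, hmem x⟩
      map_add' := fun _ _ => rfl
      map_smul' := fun _ _ => rfl }
  refine (lcClass_eq_zero_iff _).2 ⟨n + m, Nat.le_add_right n m, ?_⟩
  exact mk₀_comp_eq_zero_of_extClass (he n) (hf n) (hg n) (he (n + m)) (hf (n + m)) (hg (n + m))
      u (Submodule.subtype _) LinearMap.id _ rfl rfl c' hm

end Annihilated

section Dimension
variable {R : Type} [CommRing R]

/-- All primes in the support of `L` have coheight less than `d`; that is, `dim L < d`. -/
def DimLT (R : Type) [CommRing R] (L : Type) [AddCommGroup L] [Module R L] (d : ℕ) : Prop :=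
  ∀ q ∈ Module.support R L, ringKrullDim (R ⧸ q.asIdeal) < d

variable {L N : Type} [AddCommGroup L] [Module R L] [AddCommGroup N] [Module R N]

lemma DimLT.of_support_subset {d : ℕ} (h : DimLT R N d)
    (hs : Module.support R L ⊆ Module.support R N) : DimLT R L d :=
  fun q hq => h q (hs hq)

lemma ringKrullDim_quotient_le_moduleDim {q : PrimeSpectrum R} (hq : q ∈ Module.support R L) :
    ringKrullDim (R ⧸ q.asIdeal) ≤ moduleDim R L := by
  rw [ringKrullDim_quotient]
  exact Order.krullDim_le_of_strictMono
    (fun p => (⟨p.1, Module.mem_support_mono (show q ≤ p.1 from p.2) hq⟩ : Module.support R L))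
    fun _ _ h => h

lemma mem_support_quotient_iff {I : Ideal R} {q : PrimeSpectrum R} :
    q ∈ Module.support R (R ⧸ I) ↔ I ≤ q.asIdeal := by
  rw [Module.support_eq_zeroLocus, Ideal.annihilator_quotient]
  rfl

lemma natCast_lt_succ (d : ℕ) : ((d : ℕ) : WithBot ℕ∞) < ((d + 1 : ℕ) : WithBot ℕ∞) := by
  exact_mod_cast Nat.lt_succ_self d

lemma dimLT_succ_of_moduleDim_eq {d : ℕ} (h : moduleDim R L = d) : DimLT R L (d + 1) :=
  fun _ hq => ((ringKrullDim_quotient_le_moduleDim hq).trans h.le).trans_lt (natCast_lt_succ d)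

lemma ringKrullDim_quotient_succ_le {p q : Ideal R} [p.IsPrime] (h : p < q) :
    ringKrullDim (R ⧸ q) + 1 ≤ ringKrullDim (R ⧸ p) := by
  obtain ⟨r, hr, hrp⟩ := SetLike.exists_of_lt h
  refine ringKrullDim_succ_le_of_surjective (Ideal.Quotient.factor h.le)
    (Ideal.Quotient.factor_surjective h.le) (r := Ideal.Quotient.mk p r) ?_ ?_
  · exact mem_nonZeroDivisors_of_ne_zero (by rwa [Ne, Ideal.Quotient.eq_zero_iff_mem])
  · simpa [Ideal.Quotient.eq_zero_iff_mem] using hr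

lemma lt_of_add_one_le_of_lt_succ {x y : WithBot ℕ∞} {d : ℕ} (h : x + 1 ≤ y)
    (h' : y < ((d + 1 : ℕ) : WithBot ℕ∞)) : x < d := by
  have := h.trans_lt h'
  push_cast at this
  exact lt_of_add_lt_add_right this

/-- Grothendieck's vanishing theorem. -/
theorem subsingleton_topLC_of_dimLT [IsNoetherianRing R] (a : Ideal R) (i : ℕ) (L : Type)
    [AddCommGroup L] [Module R L] [Module.Finite R L] (hL : DimLT R L i) :
    Subsingleton (TopLC R a i L) := by
  induction i generalizing L with
  | zero =>
    have : Subsingleton L := by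
      rw [← Module.support_eq_empty_iff (R := R), Set.eq_empty_iff_forall_notMem]
      intro q hq
      have h0 := hL q hq
      have : 0 ≤ ringKrullDim (R ⧸ q.asIdeal) := ringKrullDim_nonneg_of_nontrivial
      exact absurd h0 (not_lt.2 (by simpa using this))
    exact subsingleton_topLC
  | succ i ih =>
    revert hL
    refine IsNoetherianRing.induction_on_isQuotientEquivQuotientPrime R
      (motive := fun L _ _ _ => DimLT R L (i + 1) → Subsingleton (TopLC R a (i + 1) L))
      ‹Module.Finite R L› ?_ ?_ ?_
    · intro L _ _ _ _ _
      exact subsingleton_topLC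
    · intro L _ _ _ p e hL
      by_cases hap : a ≤ p.1
      · refine subsingleton_topLC_of_annihilated (fun r hr t => e.injective ?_) i
        rw [map_smul, map_zero, ← Module.mem_annihilator.1 (?_ : r ∈ Module.annihilator R (R ⧸ p.1))]
        rw [Ideal.annihilator_quotient]
        exact hap hr
      · obtain ⟨r, hra, hrp⟩ := SetLike.not_le_iff_exists.1 hap
        have hinj : Function.Injective (r • LinearMap.id : L →ₗ[R] L) := by
          rw [injective_iff_map_eq_zero]
          intro x hx
          apply e.injective
          have h1 : r • e x = 0 := by
            rw [← map_smul]
            simpa using congrArg e hx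
          obtain ⟨y, hy⟩ := Ideal.Quotient.mk_surjective (e x)
          rw [← hy, Algebra.smul_def, Ideal.Quotient.algebraMap_eq, ← map_mul,
            Ideal.Quotient.eq_zero_iff_mem] at h1
          rw [← hy, map_zero, Ideal.Quotient.eq_zero_iff_mem]
          exact (p.2.mem_or_mem h1).resolve_left hrp
        have hdim : DimLT R (L ⧸ LinearMap.range (r • LinearMap.id : L →ₗ[R] L)) i := by
          intro q hq
          have hsup := Module.support_subset_of_surjective _ (Submodule.mkQ_surjective _) hq
          have hpq : p.1 ≤ q.asIdeal := by
            rwa [e.support_eq, mem_support_quotient_iff] at hsup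
          have hrq : r ∈ q.asIdeal := by
            refine Module.annihilator_le_of_mem_support hq ?_
            rw [Module.mem_annihilator]
            intro x
            obtain ⟨y, rfl⟩ := Submodule.mkQ_surjective _ x
            rw [← map_smul]
            exact (Submodule.Quotient.mk_eq_zero _).2 ⟨y, rfl⟩
          have hlt : p.1 < q.asIdeal := lt_of_le_of_ne hpq fun h => hrp (h ▸ hrq)
          have hp : p ∈ Module.support R L := by
            rw [e.support_eq, mem_support_quotient_iff]
          have := p.2
          exact lt_of_add_one_le_of_lt_succ (ringKrullDim_quotient_succ_le hlt) (hL p hp)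
        have hreg := lcMap_injective_of_subsingleton (a := a)
          (LinearMap.exact_map_mkQ_range (r • LinearMap.id : L →ₗ[R] L)) hinj
          (Submodule.mkQ_surjective _) (ih _ hdim)
        refine subsingleton_of_forall_eq 0 fun x => ?_
        obtain ⟨n, hn⟩ := exists_pow_smul_topLC_eq_zero x
        have hx := hn _ (Ideal.pow_mem_pow hra n)
        clear hn
        induction n with
        | zero => simpa using hx
        | succ n ihn =>
          refine ihn (hreg ?_)
          rw [lcMap_smul_id, map_zero, smul_smul, ← pow_succ', hx]
    · intro L₁ _ _ _ L₂ _ _ _ L₃ _ _ _ f g hf hg he h₁ h₃ hL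
      have := h₁ (hL.of_support_subset (Module.support_subset_of_injective f hf))
      have := h₃ (hL.of_support_subset (Module.support_subset_of_surjective g hg))
      refine subsingleton_of_forall_eq 0 fun x => ?_
      obtain ⟨y, rfl⟩ := (lcMap_exact (a := a) (i := i + 1) he hf hg x).1 (Subsingleton.elim _ _)
      rw [Subsingleton.elim y 0, map_zero]

end Dimension

section SecondarySplitting
open scoped Classical in
/-- The product of the `k`-th powers of the members of `P` other than `p`. -/
noncomputable def cofactor {R : Type} [CommRing R] (P : Finset (Ideal R)) (k : ℕ) (p : Ideal R) :
    Ideal R :=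
  ∏ q ∈ P.erase p, q ^ k

/-- The conditions on a finite set of pairwise incomparable primes ensuring that the module `X`
is the sum of its `p`-secondary parts for `p` in that set. -/
structure PrimeSplitting {R : Type} [CommRing R] (P : Finset (Ideal R)) (k : ℕ)
    (X : Type) [AddCommGroup X] [Module R X] : Prop where
  prime : ∀ p ∈ P, p.IsPrime
  eq_of_le : ∀ p ∈ P, ∀ q ∈ P, p ≤ q → p = q
  ne_zero : k ≠ 0
  smul_top : ∀ J : Ideal R, (∀ p ∈ P, ¬ J ≤ p) → J • (⊤ : Submodule R X) = ⊤
  prod_pow_smul : (∏ p ∈ P, p) ^ k • (⊤ : Submodule R X) = ⊥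

variable {R : Type} [CommRing R] {P : Finset (Ideal R)} {k : ℕ} {X : Type} [AddCommGroup X]
  [Module R X]

lemma pow_mul_cofactor {p : Ideal R} (hp : p ∈ P) :
    p ^ k * cofactor P k p = (∏ q ∈ P, q) ^ k := by
  classical
  rw [cofactor, ← Finset.prod_pow]
  convert Finset.mul_prod_erase P (fun q => q ^ k) hp

lemma cofactor_le_pow {p q : Ideal R} (hq : q ∈ P) (h : q ≠ p) : cofactor P k p ≤ q ^ k := by
  classical
  exact Ideal.le_of_dvd (Finset.dvd_prod_of_mem (fun q => q ^ k) (Finset.mem_erase.2 ⟨h, hq⟩))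

namespace PrimeSplitting

variable (h : PrimeSplitting P k X)
include h

lemma not_cofactor_le {p : Ideal R} (hp : p ∈ P) : ¬ cofactor P k p ≤ p := by
  classical
  intro hle
  have := h.prime p hp
  obtain ⟨q, hq, hqp⟩ := (Ideal.IsPrime.prod_le (h.prime p hp)).1 hle
  obtain ⟨hne, hqP⟩ := Finset.mem_erase.1 hq
  exact hne (h.eq_of_le q hqP p hp (Ideal.IsPrime.le_of_pow_le hqp))

lemma pow_smul_part {p : Ideal R} (hp : p ∈ P) :
    p ^ k • (cofactor P k p • (⊤ : Submodule R X)) = ⊥ := by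
  rw [← Submodule.mul_smul, pow_mul_cofactor hp, h.prod_pow_smul]

lemma mul_cofactor_sup_pow_smul_top {p : Ideal R} (hp : p ∈ P) {I : Ideal R} (hI : ¬ I ≤ p) :
    (I * cofactor P k p ⊔ p ^ k) • (⊤ : Submodule R X) = ⊤ := by
  refine h.smul_top _ fun q hq hle => ?_
  have hqp := h.prime q hq
  obtain ⟨h1, h2⟩ := sup_le_iff.1 hle
  obtain rfl := h.eq_of_le p hp q hq (Ideal.IsPrime.le_of_pow_le h2)
  exact ((Ideal.IsPrime.mul_le hqp).1 h1).elim hI (h.not_cofactor_le hp)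

lemma part_le {p : Ideal R} (hp : p ∈ P) {I : Ideal R} (hI : ¬ I ≤ p) :
    cofactor P k p • (⊤ : Submodule R X) ≤
      (I * cofactor P k p) • (cofactor P k p • (⊤ : Submodule R X)) := by
  conv_lhs => rw [← h.mul_cofactor_sup_pow_smul_top hp hI]
  rw [← Submodule.mul_smul, Ideal.mul_sup, Submodule.sup_smul, mul_comm _ (p ^ k), Submodule.mul_smul,
    Submodule.mul_smul (p ^ k), h.pow_smul_part hp, sup_bot_eq, ← Submodule.mul_smul,
    ← Submodule.mul_smul, mul_comm]

lemma part_smul_surj {p : Ideal R} (hp : p ∈ P) {r : R} (hr : r ∉ p) {x : X}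
    (hx : x ∈ cofactor P k p • (⊤ : Submodule R X)) :
    ∃ y ∈ cofactor P k p • (⊤ : Submodule R X), r • y = x := by
  have hI : ¬ Ideal.span {r} ≤ p := by rwa [Ideal.span_singleton_le_iff_mem]
  have := h.part_le hp hI hx
  rw [Submodule.mul_smul, Submodule.ideal_span_singleton_smul] at this
  obtain ⟨y, hy, rfl⟩ := (Submodule.mem_smul_pointwise_iff_exists _ _ _).1 this
  exact ⟨y, Submodule.smul_le_right hy, rfl⟩

lemma part_ne_bot_iff {p : Ideal R} (hp : p ∈ P) :
    cofactor P k p • (⊤ : Submodule R X) ≠ ⊥ ↔ p • (⊤ : Submodule R X) ≠ ⊤ := by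
  have hprime := h.prime p hp
  refine not_congr ⟨fun h0 => ?_, fun h1 => ?_⟩
  · have := h.mul_cofactor_sup_pow_smul_top hp (I := ⊤) (fun h => hprime.ne_top (top_le_iff.1 h))
    rw [Submodule.sup_smul, Submodule.mul_smul, h0, Submodule.smul_bot, bot_sup_eq] at this
    exact top_le_iff.1 (this.ge.trans (Submodule.smul_mono_left (Ideal.pow_le_self h.ne_zero)))
  · have hpow : ∀ n : ℕ, p ^ n • (⊤ : Submodule R X) = ⊤ := fun n => by
      induction n with
      | zero => simp
      | succ n ih => rw [pow_succ, Submodule.mul_smul, h1, ih]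
    rw [← hpow k, ← Submodule.mul_smul, mul_comm, Submodule.mul_smul, h.pow_smul_part hp]

lemma radical_annihilator_part {p : Ideal R} (hp : p ∈ P)
    (h0 : cofactor P k p • (⊤ : Submodule R X) ≠ ⊥) :
    (cofactor P k p • (⊤ : Submodule R X)).annihilator.radical = p := by
  have hprime := h.prime p hp
  apply le_antisymm
  · rintro r ⟨n, hn⟩
    by_contra hr
    refine h0 (eq_bot_iff.2 fun x hx => ?_)
    obtain ⟨y, hy, rfl⟩ := h.part_smul_surj hp (fun h => hr (hprime.mem_of_pow_mem n h)) hx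
    exact Submodule.mem_annihilator.1 hn y hy
  · intro r hr
    refine ⟨k, ?_⟩
    exact Submodule.le_annihilator_iff.2 (h.pow_smul_part hp) (Ideal.pow_mem_pow hr k)

lemma isSecondarySub_part {p : Ideal R} (hp : p ∈ P)
    (h0 : cofactor P k p • (⊤ : Submodule R X) ≠ ⊥) :
    IsSecondarySub R (cofactor P k p • (⊤ : Submodule R X)) := by
  refine ⟨h0, fun r => ?_⟩
  by_cases hr : r ∈ p
  · exact Or.inr ⟨k, Submodule.mem_annihilator.1
      (Submodule.le_annihilator_iff.2 (h.pow_smul_part hp) (Ideal.pow_mem_pow hr k))⟩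
  · exact Or.inl fun x hx => h.part_smul_surj hp hr hx

lemma iSup_part : ⨆ p : P, cofactor P k p • (⊤ : Submodule R X) = ⊤ := by
  rw [← Submodule.iSup_smul]
  refine h.smul_top _ fun q hq hle => ?_
  exact h.not_cofactor_le hq ((le_iSup (fun p : P => cofactor P k p) ⟨q, hq⟩).trans hle)

lemma cofactor_smul_part {p q : Ideal R} (hq : q ∈ P) (hne : p ≠ q) :
    cofactor P k p • (cofactor P k q • (⊤ : Submodule R X)) = ⊥ :=
  eq_bot_iff.2 ((Submodule.smul_mono_left (cofactor_le_pow hq hne.symm)).trans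
    (h.pow_smul_part hq).le)

lemma exists_isMinimalRep : ∃ (n : ℕ) (e : Fin n ≃ {p // p ∈ P ∧ p • (⊤ : Submodule R X) ≠ ⊤}),
    IsMinimalRep R (fun i => cofactor P k (e i).1 • (⊤ : Submodule R X)) := by
  classical
  have hfin : Finite {p // p ∈ P ∧ p • (⊤ : Submodule R X) ≠ ⊤} :=
    (P.finite_toSet.subset fun p hp => hp.1).to_subtype
  obtain ⟨n, ⟨e⟩⟩ := hfin.exists_equiv_fin
  have hne : ∀ i, cofactor P k (e.symm i).1 • (⊤ : Submodule R X) ≠ ⊥ := fun i =>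
    (h.part_ne_bot_iff (e.symm i).2.1).2 (e.symm i).2.2
  refine ⟨n, e.symm, fun i => h.isSecondarySub_part (e.symm i).2.1 (hne i), ?_, ?_, ?_⟩
  · refine top_le_iff.1 (h.iSup_part.ge.trans ?_)
    refine iSup_le fun p => ?_
    by_cases hp : (p : Ideal R) • (⊤ : Submodule R X) = ⊤
    · have := not_not.1 (mt (h.part_ne_bot_iff p.2).1 (not_not.2 hp))
      rw [this]
      exact bot_le
    · refine (Eq.le ?_).trans (le_iSup _ (e ⟨p, p.2, hp⟩))
      simp
  · intro i j hij
    apply e.symm.injective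
    apply Subtype.ext
    have h1 := h.radical_annihilator_part (e.symm i).2.1 (hne i)
    have h2 := h.radical_annihilator_part (e.symm j).2.1 (hne j)
    exact h1.symm.trans (hij.trans h2)
  · intro j hj
    refine hne j (eq_bot_iff.2 ?_)
    have hprime := h.prime _ (e.symm j).2.1
    have h1 := h.part_le (e.symm j).2.1 (I := ⊤) (fun h => hprime.ne_top (top_le_iff.1 h))
    rw [Ideal.top_mul] at h1
    refine h1.trans ((Submodule.smul_mono le_rfl hj).trans ?_)
    rw [Submodule.smul_iSup]
    refine iSup_le fun i => ?_
    rw [Submodule.smul_iSup]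
    refine iSup_le fun hi => (h.cofactor_smul_part (e.symm i).2.1 ?_).le
    intro heq
    exact hi (e.symm.injective (Subtype.ext heq.symm))

end PrimeSplitting

lemma IsSecondarySub.exists_smul_eq {S : Submodule R X} (hS : IsSecondarySub R S) {r : R}
    (hr : r ∉ S.annihilator.radical) (x : X) (hx : x ∈ S) : ∃ y ∈ S, r • y = x := by
  refine (hS.2 r).elim (fun h => h x hx) fun ⟨n, hn⟩ => absurd ?_ hr
  exact ⟨n, Submodule.mem_annihilator.2 hn⟩

lemma IsSecondarySub.isPrime_radical_annihilator {S : Submodule R X} (hS : IsSecondarySub R S) :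
    S.annihilator.radical.IsPrime := by
  refine ⟨fun h => hS.1 ?_, fun {r s} hrs => ?_⟩
  · rwa [Ideal.radical_eq_top, Submodule.annihilator_eq_top_iff] at h
  · by_contra! hcon
    obtain ⟨n, hn⟩ := hrs
    have hsurj : ∀ m : ℕ, ∀ x ∈ S, ∃ y ∈ S, (r * s) ^ m • y = x := by
      intro m
      induction m with
      | zero => exact fun x hx => ⟨x, hx, by simp⟩
      | succ m ih =>
        intro x hx
        obtain ⟨y, hy, rfl⟩ := hS.exists_smul_eq hcon.1 x hx
        obtain ⟨z, hz, rfl⟩ := hS.exists_smul_eq hcon.2 y hy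
        obtain ⟨w, hw, rfl⟩ := ih z hz
        exact ⟨w, hw, by rw [smul_smul, smul_smul, pow_succ, mul_comm, mul_assoc]⟩
    refine hS.1 (eq_bot_iff.2 fun x hx => ?_)
    obtain ⟨y, hy, rfl⟩ := hsurj n x hx
    exact Submodule.mem_annihilator.1 hn y hy

theorem PrimeSplitting.attachedPrimes_eq [IsNoetherianRing R] (h : PrimeSplitting P k X) :
    AttachedPrimes R X = {p | p ∈ P ∧ p • (⊤ : Submodule R X) ≠ ⊤} := by
  ext p
  constructor
  · rintro ⟨n, S, ⟨hsec, hsup, -, hirr⟩, i, rfl⟩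
    set p := (S i).annihilator.radical with hp
    have hprime : p.IsPrime := (hsec i).isPrime_radical_annihilator
    obtain ⟨m, hm⟩ := Ideal.exists_radical_pow_le_of_fg (S i).annihilator
      (IsNoetherian.noetherian _)
    have hpS : p ^ m • S i = ⊥ := Submodule.le_annihilator_iff.1 hm
    have hptop : p • (⊤ : Submodule R X) ≠ ⊤ := by
      intro h1
      have hpow : ∀ n : ℕ, p ^ n • (⊤ : Submodule R X) = ⊤ := fun n => by
        induction n with
        | zero => simp
        | succ n ih => rw [pow_succ, Submodule.mul_smul, h1, ih]
      have hle : (⊤ : Submodule R X) ≤ S i ⊔ ⨆ j ∈ ({i}ᶜ : Set (Fin n)), S j := by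
        rw [← hsup]
        refine iSup_le fun j => ?_
        by_cases hj : j = i
        · exact hj ▸ le_sup_left
        · exact (le_iSup₂ (f := fun j (_ : j ∈ ({i}ᶜ : Set (Fin n))) => S j) j hj).trans
            le_sup_right
      refine hirr i (le_top.trans ?_)
      rw [← hpow m]
      refine (Submodule.smul_mono le_rfl hle).trans ?_
      rw [Submodule.smul_sup, hpS, bot_sup_eq]
      exact Submodule.smul_le_right
    have hprod : (∏ q ∈ P, q) ^ k ≤ p := by
      refine le_trans ?_ Ideal.le_radical
      exact Submodule.le_annihilator_iff.2 (eq_bot_iff.2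
        ((Submodule.smul_mono le_rfl le_top).trans h.prod_pow_smul.le))
    obtain ⟨q, hq, hqp⟩ := (Ideal.IsPrime.prod_le hprime).1 (Ideal.IsPrime.le_of_pow_le hprod)
    have : ∃ l ∈ P, p ≤ l := by
      by_contra! hcon
      exact hptop (h.smul_top p hcon)
    obtain ⟨l, hl, hpl⟩ := this
    have hql := h.eq_of_le q hq l hl (hqp.trans hpl)
    have hpq : p = q := le_antisymm (hql ▸ hpl) hqp
    exact ⟨hpq ▸ hq, hptop⟩
  · rintro ⟨hp, hne⟩
    obtain ⟨n, e, he⟩ := h.exists_isMinimalRep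
    refine ⟨n, _, he, e.symm ⟨p, hp, hne⟩, ?_⟩
    simp only [Equiv.apply_symm_apply]
    exact (h.radical_annihilator_part hp ((h.part_ne_bot_iff hp).2 hne)).symm

end SecondarySplitting

section TopLocalCohomology
variable {R : Type} [CommRing R] {a : Ideal R} {i : ℕ}
variable {A B : Type} [AddCommGroup A] [AddCommGroup B] [Module R A] [Module R B]

lemma lcMap_smul_apply (r : R) (f : A →ₗ[R] B) (x : TopLC R a i A) :
    lcMap a i (r • f) x = r • lcMap a i f x := by
  rw [← lcMap_smul_id, ← lcMap_comp_apply, LinearMap.smul_comp, LinearMap.id_comp]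

lemma lcMap_sum_apply {ι : Type} (s : Finset ι) (f : ι → A →ₗ[R] B) (x : TopLC R a i A) :
    lcMap a i (∑ j ∈ s, f j) x = ∑ j ∈ s, lcMap a i (f j) x :=
  map_sum (AddMonoidHom.mk' (fun g : A →ₗ[R] B => lcMap a i g x)
    fun g h => lcMap_add_apply g h x) f s

lemma smul_topLC_eq_zero {r : R} (hr : r ∈ Module.annihilator R A) (x : TopLC R a i A) :
    r • x = 0 := by
  rw [← lcMap_smul_id, show (r • LinearMap.id : A →ₗ[R] A) = 0 from
    LinearMap.ext fun y => Module.mem_annihilator.1 hr y, lcMap_zero_apply]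

lemma exists_lcMap_eq_of_lcMap_mkQ_eq_zero (f : A →ₗ[R] B)
    (hker : Subsingleton (TopLC R a (i + 1) (LinearMap.ker f))) (y : TopLC R a i B)
    (hy : lcMap a i (LinearMap.range f).mkQ y = 0) : ∃ x, lcMap a i f x = y := by
  obtain ⟨z, rfl⟩ := (lcMap_exact (LinearMap.exact_subtype_mkQ (LinearMap.range f))
    (Submodule.injective_subtype _) (Submodule.mkQ_surjective _) y).1 hy
  have he : Function.Exact (LinearMap.ker f).subtype f.rangeRestrict := fun x => by
    simp [Subtype.ext_iff]
  obtain ⟨x, rfl⟩ := lcMap_surjective_of_subsingleton he (Submodule.injective_subtype _)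
    f.surjective_rangeRestrict hker z
  exact ⟨x, by rw [← lcMap_comp_apply, LinearMap.subtype_comp_codRestrict]⟩

lemma DimLT.pi {N : Type} [AddCommGroup N] [Module R N] [Module.Finite R N] {d n : ℕ}
    (h : DimLT R N d) : DimLT R (Fin n → N) d := by
  refine h.of_support_subset fun q hq => ?_
  rw [Module.support_eq_zeroLocus] at hq ⊢
  refine PrimeSpectrum.zeroLocus_anti_mono (fun r hr => ?_) hq
  exact Module.mem_annihilator.2 fun x => funext fun j => Module.mem_annihilator.1 hr (x j)

lemma DimLT.submodule {d : ℕ} (h : DimLT R A d) (S : Submodule R A) : DimLT R S d :=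
  h.of_support_subset (Module.support_subset_of_injective _ S.injective_subtype)

variable {N : Type} [AddCommGroup N] [Module R N] {d : ℕ}

lemma annihilator_le_of_mem_assh {p : Ideal R} (hp : p ∈ Assh R N) : Module.annihilator R N ≤ p :=
  Submodule.annihilator_top (R := R) (M := N) ▸ IsAssociatedPrime.annihilator_le hp.1

lemma eq_of_le_of_mem_assh [Module.Finite R N] (hN : moduleDim R N = d) {p q : Ideal R} [p.IsPrime]
    (hp : Module.annihilator R N ≤ p) (hq : q ∈ Assh R N) (h : p ≤ q) : p = q := by
  refine h.lt_or_eq.resolve_left fun hlt => ?_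
  have h1 := lt_of_add_one_le_of_lt_succ (d := d) (ringKrullDim_quotient_succ_le hlt) <|
    dimLT_succ_of_moduleDim_eq hN ⟨p, ‹_›⟩ (by rw [Module.support_eq_zeroLocus]; exact hp)
  exact h1.ne (hq.2.trans hN)

lemma dimLT_quotient_of_mem_assh [Module.Finite R N] (hN : moduleDim R N = d) {p : Ideal R} (hp : p ∈ Assh R N) :
    DimLT R (R ⧸ p) (d + 1) := by
  refine (dimLT_succ_of_moduleDim_eq hN).of_support_subset fun q hq => ?_
  rw [Module.support_eq_zeroLocus]
  exact (annihilator_le_of_mem_assh hp).trans (mem_support_quotient_iff.1 hq)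

variable [IsNoetherianRing R] [Module.Finite R N]

lemma mem_smul_top_of_lcMap_mkQ_eq_zero (hN : DimLT R N (d + 1)) (J : Ideal R)
    (y : TopLC R a d N) (hy : lcMap a d (J • ⊤ : Submodule R N).mkQ y = 0) :
    y ∈ J • (⊤ : Submodule R (TopLC R a d N)) := by
  obtain ⟨n, s, hs⟩ := Submodule.fg_iff_exists_fin_generating_family.1
    (IsNoetherian.noetherian J)
  have hsJ : ∀ j, s j ∈ J := fun j => hs ▸ Submodule.subset_span ⟨j, rfl⟩
  let f : (Fin n → N) →ₗ[R] N := ∑ j, s j • LinearMap.proj j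
  have hf : J • ⊤ = LinearMap.range f := by
    apply le_antisymm
    · refine Submodule.smul_le.2 fun r hr x _ => ?_
      rw [← hs] at hr
      obtain ⟨c, rfl⟩ := (Submodule.mem_span_range_iff_exists_fun R).1 hr
      refine ⟨fun j => c j • x, ?_⟩
      simp [f, Finset.sum_smul, smul_smul, mul_comm]
    · rintro _ ⟨x, rfl⟩
      simp only [f, LinearMap.sum_apply, LinearMap.smul_apply, LinearMap.proj_apply]
      exact Submodule.sum_mem _ fun j _ => Submodule.smul_mem_smul (hsJ j) trivial
  rw [hf] at hy
  obtain ⟨x, rfl⟩ := exists_lcMap_eq_of_lcMap_mkQ_eq_zero f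
    (subsingleton_topLC_of_dimLT a (d + 1) _ (hN.pi.submodule _)) y hy
  rw [lcMap_sum_apply]
  refine Submodule.sum_mem _ fun j _ => ?_
  rw [lcMap_smul_apply]
  exact Submodule.smul_mem_smul (hsJ j) trivial

lemma dimLT_of_disjoint_assh (hN : moduleDim R N = d)
    (hs : Module.support R A ⊆ Module.support R N)
    (hA : ∀ q ∈ Module.support R A, q.asIdeal ∉ Assh R N) : DimLT R A d := by
  intro q hq
  have hqN := hs hq
  obtain ⟨p, hp, hpq⟩ := Ideal.exists_minimalPrimes_le (Module.annihilator_le_of_mem_support hqN)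
  have hpA := Module.associatedPrimes.minimalPrimes_annihilator_subset_associatedPrimes R N hp
  have hpprime := hpA.isPrime
  rcases hpq.lt_or_eq with hlt | heq
  · refine lt_of_add_one_le_of_lt_succ (ringKrullDim_quotient_succ_le hlt) ?_
    refine dimLT_succ_of_moduleDim_eq hN ⟨p, hpprime⟩ ?_
    rw [Module.support_eq_zeroLocus]
    exact hp.1.2
  · refine lt_of_le_of_ne (hN ▸ ringKrullDim_quotient_le_moduleDim hqN) fun h => hA q hq ?_
    exact ⟨heq ▸ hpA, h.trans hN.symm⟩

lemma finite_assh (N : Type) [AddCommGroup N] [Module R N] [Module.Finite R N] :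
    (Assh R N).Finite :=
  (associatedPrimes.finite R N).subset fun _ hp => hp.1

lemma smul_topLC_eq_top (hN : moduleDim R N = d) {J : Ideal R} (hJ : ∀ p ∈ Assh R N, ¬ J ≤ p) :
    J • (⊤ : Submodule R (TopLC R a d N)) = ⊤ := by
  have hdim : DimLT R (N ⧸ (J • ⊤ : Submodule R N)) d := by
    refine dimLT_of_disjoint_assh hN
      (Module.support_subset_of_surjective _ (Submodule.mkQ_surjective _)) fun q hq hqA => ?_
    refine hJ _ hqA ?_
    refine le_trans (fun r hr => ?_) (Module.annihilator_le_of_mem_support hq)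
    rw [Module.mem_annihilator]
    intro x
    obtain ⟨y, rfl⟩ := Submodule.mkQ_surjective _ x
    rw [← map_smul]
    exact (Submodule.Quotient.mk_eq_zero _).2 (Submodule.smul_mem_smul hr trivial)
  have := subsingleton_topLC_of_dimLT a d _ hdim
  exact eq_top_iff.2 fun y _ => mem_smul_top_of_lcMap_mkQ_eq_zero
    (dimLT_succ_of_moduleDim_eq hN) J y (Subsingleton.elim _ _)

lemma exists_prod_pow_smul_topLC_eq_bot (a : Ideal R) (hN : moduleDim R N = d) :
    ∃ k ≠ 0, (∏ p ∈ (finite_assh (R := R) N).toFinset, p) ^ k •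
      (⊤ : Submodule R (TopLC R a d N)) = ⊥ := by
  classical
  set P := (finite_assh (R := R) N).toFinset with hP
  let Q := (Ideal.finite_minimalPrimes_of_isNoetherianRing R (Module.annihilator R N)).toFinset
  have hle : (∏ p ∈ P, p) * ∏ p ∈ Q \ P, p ≤ (Module.annihilator R N).radical := by
    rw [← Ideal.sInf_minimalPrimes]
    refine le_sInf fun p hp => ?_
    by_cases hpP : p ∈ P
    · exact Ideal.mul_le_left.trans (Ideal.le_of_dvd (Finset.dvd_prod_of_mem _ hpP))
    · exact Ideal.mul_le_right.trans
        (Ideal.le_of_dvd (Finset.dvd_prod_of_mem _ (by simp [Q, hp, hpP])))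
  obtain ⟨k, hk⟩ := Ideal.exists_radical_pow_le_of_fg (Module.annihilator R N)
    (IsNoetherian.noetherian _)
  have hk' := (Ideal.pow_le_pow_right k.le_succ).trans ((Ideal.pow_right_mono hle k).trans hk)
  rw [mul_pow] at hk'
  refine ⟨k + 1, k.succ_ne_zero, ?_⟩
  set J := (∏ p ∈ P, p) ^ (k + 1) with hJ
  have hdim : DimLT R (J • ⊤ : Submodule R N) d := by
    refine dimLT_of_disjoint_assh hN
      (Module.support_subset_of_injective _ (Submodule.injective_subtype _)) fun q hq hqA => ?_
    have hann : (∏ p ∈ Q \ P, p) ^ (k + 1) ≤ q.asIdeal := by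
      refine le_trans ?_ (Module.annihilator_le_of_mem_support hq)
      refine Submodule.le_annihilator_iff.2 ?_
      rw [← Submodule.mul_smul, mul_comm, ← Submodule.le_annihilator_iff,
        Submodule.annihilator_top]
      exact hk'
    obtain ⟨p, hp, hpq⟩ := (Ideal.IsPrime.prod_le q.2).1 (Ideal.IsPrime.le_of_pow_le hann)
    obtain ⟨hpQ, hpP⟩ := Finset.mem_sdiff.1 hp
    have hpmin : p ∈ (Module.annihilator R N).minimalPrimes := by simpa [Q] using hpQ
    have := hpmin.1.1
    exact hpP (by simpa [hP, eq_of_le_of_mem_assh hN hpmin.1.2 hqA hpq] using hqA)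
  have := subsingleton_topLC_of_dimLT a d _ hdim
  refine eq_bot_iff.2 (Submodule.smul_le.2 fun r hr y _ => ?_)
  let f : N →ₗ[R] (J • ⊤ : Submodule R N) :=
    (r • LinearMap.id).codRestrict _ fun x => Submodule.smul_mem_smul hr trivial
  rw [← lcMap_smul_id, show (r • LinearMap.id : N →ₗ[R] N) = Submodule.subtype _ ∘ₗ f from rfl,
    lcMap_comp_apply, Subsingleton.elim (lcMap a d f y) 0, map_zero]
  exact zero_mem _

lemma exists_primeSplitting_topLC (a : Ideal R) (hN : moduleDim R N = d) :
    ∃ k, PrimeSplitting (finite_assh (R := R) N).toFinset k (TopLC R a d N) := by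
  obtain ⟨k, hk0, hk⟩ := exists_prod_pow_smul_topLC_eq_bot a hN
  refine ⟨k, fun p hp => ?_, fun p hp q hq h => ?_, hk0, fun J hJ => ?_, hk⟩
  · rw [Set.Finite.mem_toFinset] at hp
    exact hp.1.isPrime
  · rw [Set.Finite.mem_toFinset] at hp hq
    have := hp.1.isPrime
    exact eq_of_le_of_mem_assh hN (annihilator_le_of_mem_assh hp) hq h
  · exact smul_topLC_eq_top hN (by simpa using hJ)

lemma exists_lcMap_surjective_of_mem_assh (a : Ideal R) (hN : moduleDim R N = d) {p : Ideal R}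
    (hp : p ∈ Assh R N) : ∃ f : N →ₗ[R] R ⧸ p, Function.Surjective (lcMap a d f) := by
  have hprime := hp.1.isPrime
  have hnt : ¬ Subsingleton (N →ₗ[R] R ⧸ p) := by
    rw [IsSMulRegular.subsingleton_linearMap_iff]
    rintro ⟨r, hr, hreg⟩
    have hrp : r ∈ Module.annihilator R (R ⧸ p) := by
      rw [Ideal.annihilator_quotient]
      exact annihilator_le_of_mem_assh hp hr
    refine one_ne_zero (α := R ⧸ p) (hreg ?_)
    simp only [Module.mem_annihilator.1 hrp]
  rw [not_subsingleton_iff_nontrivial] at hnt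
  obtain ⟨f, hf⟩ := exists_ne (0 : N →ₗ[R] R ⧸ p)
  obtain ⟨x, hx⟩ : ∃ x, f x ≠ 0 := by
    by_contra! h
    exact hf (LinearMap.ext h)
  obtain ⟨r, hr⟩ := Ideal.Quotient.mk_surjective (f x)
  have hrp : r ∉ p := by
    rwa [← Ideal.Quotient.eq_zero_iff_mem, hr]
  have hdim : DimLT R ((R ⧸ p) ⧸ LinearMap.range f) d := by
    intro q hq
    have hpq : p ≤ q.asIdeal := mem_support_quotient_iff.1
      (Module.support_subset_of_surjective _ (Submodule.mkQ_surjective _) hq)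
    have hrq : r ∈ q.asIdeal := by
      refine Module.annihilator_le_of_mem_support hq ?_
      rw [Module.mem_annihilator]
      intro y
      obtain ⟨y, rfl⟩ := Submodule.mkQ_surjective _ y
      obtain ⟨s, rfl⟩ := Ideal.Quotient.mk_surjective y
      rw [← map_smul]
      refine (Submodule.Quotient.mk_eq_zero _).2 ⟨s • x, ?_⟩
      rw [map_smul, ← hr, Algebra.smul_def, Algebra.smul_def, mul_comm]
      rfl
    have hlt : p < q.asIdeal := lt_of_le_of_ne hpq fun h => hrp (h ▸ hrq)
    refine lt_of_add_one_le_of_lt_succ (ringKrullDim_quotient_succ_le hlt) ?_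
    rw [hp.2, hN]
    exact natCast_lt_succ d
  have := subsingleton_topLC_of_dimLT a d _ hdim
  exact ⟨f, fun y => exists_lcMap_eq_of_lcMap_mkQ_eq_zero f (subsingleton_topLC_of_dimLT a (d + 1) _
    ((dimLT_succ_of_moduleDim_eq hN).submodule _)) y (Subsingleton.elim _ _)⟩

/-- Top local cohomology of a module killed by `p` is covered by that of copies of `R ⧸ p`. -/
lemma exists_smul_topLC_eq_zero_of_annihilated {p : Ideal R} (hp : DimLT R (R ⧸ p) (d + 1))
    (hpN : ∀ r ∈ p, ∀ x : N, r • x = 0) {q : PrimeSpectrum R}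
    (hq : q ∉ Module.support R (TopLC R a d (R ⧸ p))) (y : TopLC R a d N) :
    ∃ r ∉ q.asIdeal, r • y = 0 := by
  obtain ⟨n, s, hs⟩ := Module.Finite.exists_fin (R := R) (M := N)
  let g : Fin n → (R ⧸ p) →ₗ[R] N := fun j =>
    Submodule.liftQ p (LinearMap.toSpanSingleton R N (s j)) fun r hr => hpN r hr (s j)
  let f : (Fin n → R ⧸ p) →ₗ[R] N := ∑ j, g j ∘ₗ LinearMap.proj j
  have hf : LinearMap.range f = ⊤ := by
    rw [eq_top_iff, ← hs, Submodule.span_le]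
    rintro _ ⟨j, rfl⟩
    refine ⟨Pi.single j 1, ?_⟩
    simp only [f, LinearMap.sum_apply, LinearMap.comp_apply, LinearMap.proj_apply]
    rw [Finset.sum_eq_single j (fun l _ hl => by rw [Pi.single_eq_of_ne hl, map_zero]) (by simp),
      Pi.single_eq_same]
    exact one_smul R (s j)
  have hsub : Subsingleton (N ⧸ LinearMap.range f) := by
    rw [hf]
    infer_instance
  have := subsingleton_topLC (a := a) (i := d) (A := N ⧸ LinearMap.range f) (R := R)
  obtain ⟨x, rfl⟩ := exists_lcMap_eq_of_lcMap_mkQ_eq_zero f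
    (subsingleton_topLC_of_dimLT a (d + 1) _ (hp.pi.submodule _)) y (Subsingleton.elim _ _)
  rw [Module.notMem_support_iff'] at hq
  choose r hr hr0 using fun j => hq (lcMap a d (LinearMap.proj j) x)
  refine ⟨∏ j, r j, fun h => ?_, ?_⟩
  · obtain ⟨j, -, hj⟩ := (Ideal.IsPrime.prod_mem_iff (p := q.asIdeal)).1 h
    exact hr j hj
  · rw [lcMap_sum_apply, Finset.smul_sum]
    refine Finset.sum_eq_zero fun j hj => ?_
    rw [lcMap_comp_apply, ← map_smul, ← Finset.prod_erase_mul _ _ hj, mul_smul, hr0, smul_zero,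
      map_zero]

lemma exists_smul_mem_smul_top (hN : moduleDim R N = d) {p : Ideal R} (hp : p ∈ Assh R N)
    {q : PrimeSpectrum R} (hq : q ∉ Module.support R (TopLC R a d (R ⧸ p)))
    (y : TopLC R a d N) :
    ∃ r ∉ q.asIdeal, r • y ∈ p • (⊤ : Submodule R (TopLC R a d N)) := by
  obtain ⟨r, hr, hr0⟩ := exists_smul_topLC_eq_zero_of_annihilated
    (N := N ⧸ (p • ⊤ : Submodule R N)) (dimLT_quotient_of_mem_assh hN hp)
    (fun r hr x => by
      obtain ⟨x, rfl⟩ := Submodule.mkQ_surjective _ x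
      rw [← map_smul]
      exact (Submodule.Quotient.mk_eq_zero _).2 (Submodule.smul_mem_smul hr trivial))
    hq (lcMap a d (Submodule.mkQ _) y)
  refine ⟨r, hr, mem_smul_top_of_lcMap_mkQ_eq_zero (dimLT_succ_of_moduleDim_eq hN) p _ ?_⟩
  rw [map_smul, hr0]

lemma smul_topLC_ne_top_iff (hN : moduleDim R N = d) {p : Ideal R} (hp : p ∈ Assh R N) :
    p • (⊤ : Submodule R (TopLC R a d N)) ≠ ⊤ ↔ Nontrivial (TopLC R a d (R ⧸ p)) := by
  rw [← not_subsingleton_iff_nontrivial]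
  refine not_congr ⟨fun h => ?_, fun h => ?_⟩
  · obtain ⟨f, hf⟩ := exists_lcMap_surjective_of_mem_assh a hN hp
    refine subsingleton_of_forall_eq 0 fun x => ?_
    obtain ⟨y, rfl⟩ := hf x
    have hy : y ∈ p • (⊤ : Submodule R (TopLC R a d N)) := by
      rw [h]
      trivial
    refine Submodule.smul_induction_on hy (fun r hr z _ => ?_) fun z w hz hw => ?_
    · rw [map_smul]
      exact smul_topLC_eq_zero (by rwa [Ideal.annihilator_quotient]) _
    · rw [map_add, hz, hw, add_zero]
  · have hprime := hp.1.isPrime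
    refine eq_top_iff.2 fun y _ => ?_
    have hempty : ∀ q, q ∉ Module.support R (TopLC R a d (R ⧸ p)) := by
      simp [Module.support_eq_empty]
    by_contra hy
    let I : Ideal R := (p • (⊤ : Submodule R (TopLC R a d N))).colon {y}
    have hI : I ≠ ⊤ := fun hI => hy (by
      simpa using Submodule.mem_colon_singleton.1 (show (1 : R) ∈ I from hI ▸ trivial))
    obtain ⟨m, hm, hIm⟩ := Ideal.exists_le_maximal I hI
    obtain ⟨r, hr, hry⟩ := exists_smul_mem_smul_top hN hp (hempty ⟨m, hm.isPrime⟩) y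
    exact hr (hIm (Submodule.mem_colon_singleton.2 hry))

/-- The attached primes of top local cohomology are determined by the primes in `Assh`. -/
theorem attachedPrimes_topLC (hN : moduleDim R N = d) :
    AttachedPrimes R (TopLC R a d N) = {p | p ∈ Assh R N ∧ Nontrivial (TopLC R a d (R ⧸ p))} := by
  obtain ⟨k, hk⟩ := exists_primeSplitting_topLC a hN
  rw [hk.attachedPrimes_eq]
  ext p
  simp only [Set.Finite.mem_toFinset, Set.mem_ofPred_eq]
  exact and_congr_right fun hp => smul_topLC_ne_top_iff hN hp

/-- The support of top local cohomology is determined by the primes in `Assh`. -/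
theorem support_topLC (hN : moduleDim R N = d) :
    Module.support R (TopLC R a d N) =
      ⋃ p ∈ Assh R N, Module.support R (TopLC R a d (R ⧸ p)) := by
  apply subset_antisymm
  · intro q hq
    by_contra hcon
    simp only [Set.mem_iUnion, not_exists] at hcon
    refine absurd hq (Module.notMem_support_iff'.2 ?_)
    let T : Ideal R → Prop := fun J => ∀ y : TopLC R a d N, ∃ r ∉ q.asIdeal,
      r • y ∈ J • (⊤ : Submodule R (TopLC R a d N))
    have hone : T 1 := fun y => ⟨1, q.2.one_notMem, by simp⟩
    have hmul : ∀ I J : Ideal R, T I → T J → T (I * J) := by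
      intro I J hI hJ y
      obtain ⟨r, hr, hry⟩ := hI y
      suffices h : ∀ z ∈ I • (⊤ : Submodule R (TopLC R a d N)), ∃ s ∉ q.asIdeal,
          s • z ∈ (I * J) • (⊤ : Submodule R (TopLC R a d N)) by
        obtain ⟨s, hs, hsz⟩ := h _ hry
        refine ⟨s * r, fun h => (q.2.mem_or_mem h).elim hs hr, ?_⟩
        rwa [mul_smul s r y]
      intro z hz
      rw [Submodule.mul_smul]
      refine Submodule.smul_induction_on hz (fun c hc w _ => ?_) fun w₁ w₂ h₁ h₂ => ?_
      · obtain ⟨s, hs, hsw⟩ := hJ w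
        refine ⟨s, hs, ?_⟩
        rw [smul_comm s c w]
        exact Submodule.smul_mem_smul hc hsw
      · obtain ⟨s₁, hs₁, h₁⟩ := h₁
        obtain ⟨s₂, hs₂, h₂⟩ := h₂
        refine ⟨s₁ * s₂, fun h => (q.2.mem_or_mem h).elim hs₁ hs₂, ?_⟩
        rw [smul_add]
        refine add_mem ?_ ?_
        · rw [mul_comm s₁ s₂, mul_smul s₂ s₁ w₁]
          exact Submodule.smul_mem _ _ h₁
        · rw [mul_smul s₁ s₂ w₂]
          exact Submodule.smul_mem _ _ h₂
    obtain ⟨k, -, hk⟩ := exists_prod_pow_smul_topLC_eq_bot a hN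
    have hprod : T (∏ p ∈ (finite_assh (R := R) N).toFinset, p) :=
      Finset.prod_induction _ T hmul hone fun p hp =>
        exists_smul_mem_smul_top hN (by simpa using hp) (hcon p (by simpa using hp))
    have hpow : ∀ n : ℕ, T ((∏ p ∈ (finite_assh (R := R) N).toFinset, p) ^ n) := fun n => by
      induction n with
      | zero => simpa using hone
      | succ n ih => exact pow_succ (M := Ideal R) _ n ▸ hmul _ _ ih hprod
    intro y
    obtain ⟨r, hr, hry⟩ := hpow k y
    rw [hk] at hry
    exact ⟨r, hr, hry⟩
  · refine Set.iUnion₂_subset fun p hp => ?_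
    obtain ⟨f, hf⟩ := exists_lcMap_surjective_of_mem_assh a hN hp
    exact Module.support_subset_of_surjective _ hf

end TopLocalCohomology

end

/-- If `M` and `N` are finitely generated modules of the same finite dimension
`d` with `Assh_R N = Assh_R M`, then `Att_R H^d_a(N) = Att_R H^d_a(M)` and
`Supp_R H^d_a(N) = Supp_R H^d_a(M)`; in particular `H^d_a(N) = 0 ↔ H^d_a(M) = 0`. -/
theorem stmt_9 (R : Type) [CommRing R] [IsNoetherianRing R] (a : Ideal R)
    (M : Type) [AddCommGroup M] [Module R M] [Module.Finite R M]
    (N : Type) [AddCommGroup N] [Module R N] [Module.Finite R N]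
    (d : ℕ) (hdM : moduleDim R M = (d : WithBot ℕ∞)) (hdN : moduleDim R N = (d : WithBot ℕ∞))
    (hassh : Assh R N = Assh R M) :
    AttachedPrimes R (TopLC R a d N) = AttachedPrimes R (TopLC R a d M) ∧
    Module.support R (TopLC R a d N) = Module.support R (TopLC R a d M) ∧
    (Subsingleton (TopLC R a d N) ↔ Subsingleton (TopLC R a d M)) := by
  have h : Module.support R (TopLC R a d N) = Module.support R (TopLC R a d M) := by
    rw [support_topLC hdN, support_topLC hdM, hassh]
  refine ⟨by rw [attachedPrimes_topLC hdN, attachedPrimes_topLC hdM, hassh], h, ?_⟩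
  rw [← Module.support_eq_empty_iff (R := R), h, Module.support_eq_empty_iff]
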